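/- Let 𝒜 be a Grothendieck abelian category, and fix a ring R together with an adjoint pair of additive functors F : Mod R → 𝒜 and G : 𝒜 → Mod R (F left adjoint to G) such that F is exact and the counit F ∘ G ≅ id is an isomorphism. Let μ be an infinite cardinal with μ ≥ |R| and let ν = μ⁺ be its successor cardinal. Then for every regular cardinal λ ≥ ν the following holds: given morphisms x → y and n → y in 𝒜 with x → y an epimorphism and n λ-presentable, there exist a λ-presentable object m and morphisms m → n (an epimorphism) and m → x making the square m → n, m → x, x → y, n → y commute; moreover, if n → y is a monomorphism, then m → x may be chosen to be a monomorphism. -/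

import Mathlib

open CategoryTheory Limits Opposite

universe v u

/-- A small category `J` is `κ`-filtered if every functor to `J` from a small category with
fewer than `κ` arrows admits a cocone. -/
def IsCardinalFiltered (J : Type v) [SmallCategory J] (κ : Cardinal.{v}) : Prop :=
  ∀ (K : Type v) [SmallCategory K], Cardinal.mk (Arrow K) < κ →
    ∀ (F : K ⥤ J), Nonempty (Cocone F)

/-- An object `a` of a category is `κ`-presentable if the functor `Hom(a, -)`
preserves colimits indexed by `κ`-filtered categories. -/
def IsPresentable {𝒜 : Type u} [Category.{v} 𝒜] (κ : Cardinal.{v}) (a : 𝒜) : Prop :=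
  ∀ (J : Type v) [SmallCategory J], IsCardinalFiltered J κ →
    Nonempty (PreservesColimitsOfShape J (coyoneda.obj (op a)))


section ModuleCardinality

open Cardinal

variable {R : Type v} [Ring R] {lam : Cardinal.{v}}

theorem Cardinal.mk_finsupp_lt {X S : Type v} [Zero S] (hlam : ℵ₀ < lam)
    (hX : #X < lam) (hS : #S < lam) : #(X →₀ S) < lam := by
  by_cases h : Finite X ∧ Finite S
  · obtain ⟨_, _⟩ := h
    have := Finite.of_injective (fun f : X →₀ S ↦ (f : X → S)) DFunLike.coe_injective
    exact (Cardinal.mk_lt_aleph0 (α := X →₀ S)).trans hlam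
  cases isEmpty_or_nonempty X
  · exact (Cardinal.mk_lt_aleph0 (α := X →₀ S)).trans hlam
  cases subsingleton_or_nontrivial S
  · exact (Cardinal.mk_lt_aleph0 (α := X →₀ S)).trans hlam
  cases finite_or_infinite X
  · cases finite_or_infinite S
    · exact absurd ⟨inferInstance, inferInstance⟩ h
    · rw [mk_finsupp_of_infinite']
      exact max_lt hX hS
  · rw [mk_finsupp_of_infinite]
    exact max_lt hX hS

theorem Submodule.mk_span_lt {M : Type v} [AddCommGroup M] [Module R M] (hlam : ℵ₀ < lam)
    (hR : #R < lam) {s : Set M} (hs : #s < lam) : #(Submodule.span R s) < lam := by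
  have hspan : (Submodule.span R s : Set M) ⊆
      Set.range (Finsupp.linearCombination R (Subtype.val : s → M)) := by
    intro x hx
    rwa [← LinearMap.coe_range, Finsupp.range_linearCombination, Subtype.range_coe]
  exact ((mk_le_mk_of_subset hspan).trans mk_range_le).trans_lt (mk_finsupp_lt hlam hs hR)

variable [Fact lam.IsRegular]

theorem ModuleCat.isCardinalPresentable_free {X : Type v} (hX : #X < lam) :
    IsCardinalPresentable ((ModuleCat.free R).obj X) lam := by
  have : IsCardinalPresentable X lam :=
    (Types.isCardinalPresentable_iff lam).2 ((hasCardinalLT_iff_cardinal_mk_lt X lam).2 hX)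
  have : (forget (ModuleCat.{v} R)).IsCardinalAccessible lam :=
    ⟨fun J _ _ ↦ by
      have := isFiltered_of_isCardinalFiltered J lam
      infer_instance⟩
  exact (ModuleCat.adj R).isCardinalPresentable_leftAdjoint_obj lam X

theorem ModuleCat.isCardinalPresentable_of_mk_lt (hlam : ℵ₀ < lam) (hR : #R < lam)
    (M : ModuleCat.{v} R) (hM : #M < lam) : IsCardinalPresentable M lam := by
  have hfree : #((ModuleCat.free R).obj M) < lam := mk_finsupp_lt hlam hM hR
  let p : (ModuleCat.free R).obj M ⟶ M := (ModuleCat.adj R).counit.app M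
  have hK : #(kernel p : ModuleCat.{v} R) < lam :=
    (mk_le_of_injective ((ModuleCat.mono_iff_injective (kernel.ι p)).1 inferInstance)).trans_lt
      hfree
  let f : (ModuleCat.free R).obj (kernel p : ModuleCat.{v} R) ⟶ (ModuleCat.free R).obj M :=
    (ModuleCat.adj R).counit.app (kernel p) ≫ kernel.ι p
  have h₁ := isCardinalPresentable_free (R := R) hM
  have h₂ := isCardinalPresentable_free (R := R) hK
  have (k : WalkingParallelPair) : IsCardinalPresentable ((parallelPair f 0).obj k) lam := by
    cases k
    · exact h₂
    · exact h₁
  refine isCardinalPresentable_of_isColimit' _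
    (isCokernelEpiComp (Abelian.epiIsCokernelOfKernel _ (kernelIsKernel p))
      ((ModuleCat.adj R).counit.app (kernel p)) (h := f) rfl) lam
    (hasCardinalLT_of_finite _ _ hlam.le)

end ModuleCardinality

section Localization

open Cardinal

variable {𝒜 : Type u} [Category.{v} 𝒜] {R : Type v} [Ring R]
  (F : ModuleCat.{v} R ⥤ 𝒜) {G : 𝒜 ⥤ ModuleCat.{v} R} (lam : Cardinal.{v})

/-- The morphisms between modules of cardinality `< lam` that are inverted by `F`. -/
def smallInverted : MorphismProperty (ModuleCat.{v} R) :=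
  fun X Y f ↦ IsIso (F.map f) ∧ #X < lam ∧ #Y < lam

variable {F}

theorem smallInverted_isLocal_obj (adj : F ⊣ G) (x : 𝒜) :
    (smallInverted F lam).isLocal (G.obj x) := by
  intro X Y f hf
  have := hf.1
  have : (fun g : Y ⟶ G.obj x ↦ f ≫ g) =
      adj.homEquiv X x ∘ (fun g ↦ F.map f ≫ g) ∘ (adj.homEquiv Y x).symm := by
    ext1 g
    simp [← adj.homEquiv_naturality_left_symm]
  rw [this]
  refine (adj.homEquiv X x).bijective.comp (Function.Bijective.comp ?_
    (adj.homEquiv Y x).symm.bijective)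
  exact ((asIso (F.map f)).symm.homFromEquiv).bijective

variable {lam} [Abelian 𝒜] [F.Additive] [PreservesFiniteLimits F]

theorem isIso_unit_of_smallInverted_isLocal (adj : F ⊣ G) [IsIso adj.counit]
    (hlam : ℵ₀ < lam) (hR : #R < lam) {N : ModuleCat.{v} R}
    (hN : (smallInverted F lam).isLocal N) : IsIso (adj.unit.app N) := by
  have hspan {M : ModuleCat.{v} R} (x : M) : #(Submodule.span R {x}) < lam :=
    Submodule.mk_span_lt hlam hR ((mk_lt_aleph0 (α := ({x} : Set M))).trans hlam)
  have hη : IsIso (F.map (adj.unit.app N)) := by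
    let ε : F.obj (G.obj (F.obj N)) ⟶ F.obj N := adj.counit.app (F.obj N)
    have : IsIso ε := inferInstanceAs (IsIso (adj.counit.app (F.obj N)))
    have hε : F.map (adj.unit.app N) ≫ ε = 𝟙 (F.obj N) := adj.left_triangle_components N
    have : IsIso (F.map (adj.unit.app N) ≫ ε) := hε ▸ IsIso.id _
    exact IsIso.of_isIso_comp_right _ ε
  have hmono : Mono (adj.unit.app N) := by
    rw [ModuleCat.mono_iff_injective, injective_iff_map_eq_zero]
    intro x hx
    let i : ModuleCat.of R (Submodule.span R {x}) ⟶ N := ModuleCat.ofHom (Submodule.subtype _)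
    have : Mono i := (ModuleCat.mono_iff_injective _).2 Subtype.val_injective
    have hi : i ≫ adj.unit.app N = 0 := by
      ext ⟨y, hy⟩
      obtain ⟨r, rfl⟩ := Submodule.mem_span_singleton.1 hy
      change (adj.unit.app N) (r • x) = 0
      rw [map_smul, hx, smul_zero]
    have hFi : F.map i = 0 := by
      have : Mono (F.map (adj.unit.app N)) := IsIso.mono_of_iso _
      rw [← cancel_mono (F.map (adj.unit.app N)), ← F.map_comp, hi, F.map_zero, zero_comp]
    have : Mono (F.map i) := preserves_mono_of_preservesLimit F i
    have h₀ : IsZero (F.obj (ModuleCat.of R (Submodule.span R {x}))) :=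
      IsZero.of_mono_eq_zero _ hFi
    have hW : smallInverted F lam
        (0 : ModuleCat.of R (Submodule.span R {x}) ⟶ ModuleCat.of R PUnit.{v + 1}) :=
      ⟨isIso_of_source_target_iso_zero _ h₀.isoZero
        (F.map_isZero (ModuleCat.isZero_of_subsingleton
          (ModuleCat.of R PUnit.{v + 1}))).isoZero, hspan x,
        (mk_lt_aleph0 (α := PUnit.{v + 1})).trans hlam⟩
    obtain ⟨t, ht⟩ := (hN (0 : ModuleCat.of R (Submodule.span R {x}) ⟶
      ModuleCat.of R PUnit.{v + 1}) hW).2 i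
    have hi₀ : i = 0 := by simpa using ht.symm
    exact congr($hi₀ ⟨x, Submodule.mem_span_singleton_self x⟩)
  have hepi : Epi (adj.unit.app N) := by
    rw [ModuleCat.epi_iff_surjective]
    intro z
    let i : ModuleCat.of R (Submodule.span R {z}) ⟶ G.obj (F.obj N) :=
      ModuleCat.ofHom (Submodule.subtype _)
    have hW : smallInverted F lam (pullback.snd (adj.unit.app N) i) := by
      refine ⟨?_, ?_, hspan z⟩
      · have sq := (IsPullback.of_hasPullback (adj.unit.app N) i).map F
        exact sq.isIso_snd_of_isIso
      · exact (mk_le_of_injective ((ModuleCat.mono_iff_injective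
          (pullback.snd (adj.unit.app N) i)).1 inferInstance)).trans_lt (hspan z)
    obtain ⟨t, ht⟩ := (hN _ hW).2 (pullback.fst _ _)
    have hti : t ≫ adj.unit.app N = i := by
      refine (smallInverted_isLocal_obj lam adj _ _ hW).1 ?_
      dsimp at ht ⊢
      rw [← Category.assoc, ht, pullback.condition]
    exact ⟨t ⟨z, Submodule.mem_span_singleton_self z⟩,
      congr($hti ⟨z, Submodule.mem_span_singleton_self z⟩)⟩
  exact isIso_of_mono_of_epi _

theorem isCardinalAccessible_rightAdjoint [Fact lam.IsRegular] (adj : F ⊣ G) [IsIso adj.counit]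
    (hlam : ℵ₀ < lam) (hR : #R < lam) : G.IsCardinalAccessible lam := by
  let W := smallInverted F lam
  have := W.isCardinalAccessible_ι_isLocal lam fun X Y f hf ↦
    ⟨ModuleCat.isCardinalPresentable_of_mk_lt hlam hR X hf.2.1,
      ModuleCat.isCardinalPresentable_of_mk_lt hlam hR Y hf.2.2⟩
  let G' := W.isLocal.lift G (smallInverted_isLocal_obj lam adj)
  have hff := adj.fullyFaithfulROfIsIsoCounit
  have := hff.full
  have := hff.faithful
  have : G'.EssSurj := ⟨fun N ↦ by
    have := isIso_unit_of_smallInverted_isLocal adj hlam hR N.property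
    exact ⟨F.obj N.obj, ⟨W.isLocal.isoMk (asIso (adj.unit.app N.obj)).symm⟩⟩⟩
  have : G'.IsEquivalence := {}
  exact inferInstanceAs ((G' ⋙ W.isLocal.ι).IsCardinalAccessible lam)

end Localization

section Cover

open Cardinal

variable {𝒜 : Type u} [Category.{v} 𝒜]

theorem isPresentable_iff_isCardinalPresentable {lam : Cardinal.{v}} [Fact lam.IsRegular]
    (a : 𝒜) : _root_.IsPresentable lam a ↔ IsCardinalPresentable a lam := by
  have hJ (J : Type v) [SmallCategory J] :
      _root_.IsCardinalFiltered J lam ↔ CategoryTheory.IsCardinalFiltered J lam :=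
    ⟨fun h ↦ ⟨fun {A} _ K hA ↦ h A ((hasCardinalLT_iff_cardinal_mk_lt _ _).1 hA) K⟩,
      fun h A _ hA K ↦ h.nonempty_cocone K ((hasCardinalLT_iff_cardinal_mk_lt _ _).2 hA)⟩
  exact ⟨fun h ↦ ⟨fun J _ hJ' ↦ (h J ((hJ J).2 hJ')).some⟩,
    fun h J _ hJ' ↦ by
      have := (hJ J).1 hJ'
      exact ⟨preservesColimitsOfShape_of_isCardinalPresentable a lam J⟩⟩

variable [Abelian 𝒜]

/-- The diagram of cokernels of a cocone. -/
noncomputable def cokernelDiagram {J : Type v} [SmallCategory J] {D : J ⥤ 𝒜} (c : Cocone D) :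
    J ⥤ 𝒜 where
  obj j := cokernel (c.ι.app j)
  map {i j} f := cokernel.desc _ (cokernel.π (c.ι.app j)) (by
    rw [← c.w f, Category.assoc, cokernel.condition, comp_zero])

/-- The projections from the point of a cocone to the cokernels of its components. -/
noncomputable def cokernelDiagramπ {J : Type v} [SmallCategory J] {D : J ⥤ 𝒜} (c : Cocone D) :
    (Functor.const J).obj c.pt ⟶ cokernelDiagram c where
  app j := cokernel.π (c.ι.app j)
  naturality i j f := by
    refine (Category.id_comp _).trans (Eq.symm ?_)
    exact cokernel.π_desc _ _ _

theorem exists_epi_of_jointly_epi [HasColimits 𝒜] {lam : Cardinal.{v}} [Fact lam.IsRegular]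
    {J : Type v} [SmallCategory J] [CategoryTheory.IsCardinalFiltered J lam] {D : J ⥤ 𝒜}
    (c : Cocone D) [IsCardinalPresentable c.pt lam]
    (hc : ∀ {t : 𝒜} (f : c.pt ⟶ t), (∀ j, c.ι.app j ≫ f = 0) → f = 0) :
    ∃ j, Epi (c.ι.app j) := by
  have := isFiltered_of_isCardinalFiltered J lam
  let π (j : J) : c.pt ⟶ (cokernelDiagram c).obj j := (cokernelDiagramπ c).app j
  have hπ {i j : J} (f : i ⟶ j) : π i ≫ (cokernelDiagram c).map f = π j :=
    ((cokernelDiagramπ c).naturality f).symm.trans (Category.id_comp _)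
  have hιπ (j : J) : c.ι.app j ≫ π j = 0 := cokernel.condition _
  obtain ⟨i⟩ := IsFiltered.nonempty (C := J)
  have hzero : π i ≫ colimit.ι (cokernelDiagram c) i = 0 := by
    refine hc _ fun j ↦ ?_
    have : π i ≫ colimit.ι _ i = π j ≫ colimit.ι _ j := by
      rw [← colimit.w _ (IsFiltered.leftToMax i j), ← colimit.w _ (IsFiltered.rightToMax i j),
        ← Category.assoc, ← Category.assoc, hπ, hπ]
    rw [this, ← Category.assoc, hιπ, zero_comp]
  obtain ⟨j, f, hf⟩ := IsCardinalPresentable.exists_eq_of_isColimit' lam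
    (colimit.isColimit (cokernelDiagram c)) (π i) 0 (hzero.trans zero_comp.symm)
  refine ⟨j, Preadditive.epi_of_cokernel_zero (show π j = 0 from ?_)⟩
  rw [← hπ f, hf, zero_comp]

/-- The diagram of the submodules of `M` generated by fewer than `lam` elements. -/
def spanDiagram {R : Type v} [Ring R] (M : ModuleCat.{v} R) (lam : Cardinal.{v}) :
    HasCardinalLT.Set M lam ⥤ ModuleCat.{v} R where
  obj s := ModuleCat.of R (Submodule.span R s.1)
  map f := ModuleCat.ofHom (Submodule.inclusion (Submodule.span_mono (leOfHom f)))

/-- The cocone of inclusions on `spanDiagram M lam`. -/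
def spanCocone {R : Type v} [Ring R] (M : ModuleCat.{v} R) (lam : Cardinal.{v}) :
    Cocone (spanDiagram M lam) where
  pt := M
  ι := { app s := ModuleCat.ofHom (Submodule.subtype _) }

theorem exists_presentable_subobject_epi [HasColimits 𝒜] {R : Type v} [Ring R]
    {F : ModuleCat.{v} R ⥤ 𝒜} {G : 𝒜 ⥤ ModuleCat.{v} R} (adj : F ⊣ G)
    [F.Additive] [PreservesFiniteLimits F] [IsIso adj.counit] {lam : Cardinal.{v}} [Fact lam.IsRegular]
    (hlam : ℵ₀ < lam) (hR : #R < lam) {x n : 𝒜} (p : x ⟶ n) [Epi p]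
    [IsCardinalPresentable n lam] :
    ∃ (m : 𝒜) (i : m ⟶ x), IsCardinalPresentable m lam ∧ Mono i ∧ Epi (i ≫ p) := by
  have := isCardinalAccessible_rightAdjoint adj hlam hR
  let ε : F.obj (G.obj x) ⟶ x := adj.counit.app x
  have : IsIso ε := inferInstanceAs (IsIso (adj.counit.app x))
  let q : F.obj (G.obj x) ⟶ n := ε ≫ p
  let c : Cocone (spanDiagram (G.obj x) lam ⋙ F) :=
    (F.mapCocone (spanCocone (G.obj x) lam)).extend q
  have : IsCardinalPresentable c.pt lam := ‹IsCardinalPresentable n lam›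
  obtain ⟨s, hs⟩ := exists_epi_of_jointly_epi (lam := lam) c fun {t} f hf ↦ by
    have hqf : q ≫ f = 0 := by
      apply (adj.homEquiv _ _).injective
      ext y
      let s : HasCardinalLT.Set (G.obj x) lam :=
        ⟨{y}, hasCardinalLT_of_finite _ _ hlam.le⟩
      have h : (spanCocone (G.obj x) lam).ι.app s ≫ adj.homEquiv _ _ (q ≫ f) =
          (spanCocone (G.obj x) lam).ι.app s ≫ adj.homEquiv _ _ 0 := by
        rw [← adj.homEquiv_naturality_left, ← adj.homEquiv_naturality_left, comp_zero]
        congr 1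
        exact (Category.assoc _ _ _).symm.trans (hf s)
      exact congr($h ⟨y, Submodule.mem_span_singleton_self y⟩)
    rwa [← cancel_epi q, comp_zero]
  have : Mono ((spanCocone (G.obj x) lam).ι.app s) :=
    (ModuleCat.mono_iff_injective _).2 Subtype.val_injective
  let i : F.obj ((spanDiagram (G.obj x) lam).obj s) ⟶ F.obj (G.obj x) :=
    F.map ((spanCocone (G.obj x) lam).ι.app s)
  have : Mono i := inferInstanceAs (Mono (F.map ((spanCocone (G.obj x) lam).ι.app s)))
  have : IsCardinalPresentable ((spanDiagram (G.obj x) lam).obj s) lam :=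
    ModuleCat.isCardinalPresentable_of_mk_lt hlam hR _
      (Submodule.mk_span_lt hlam hR ((hasCardinalLT_iff_cardinal_mk_lt _ _).1 s.2))
  refine ⟨F.obj ((spanDiagram (G.obj x) lam).obj s),
    i ≫ ε, adj.isCardinalPresentable_leftAdjoint_obj lam _, inferInstance, ?_⟩
  rw [Category.assoc]
  exact hs

end Cover

/-- Let `𝒜` be a Grothendieck abelian category, `R` a ring, `F ⊣ G` an adjoint pair of
additive functors with `F` exact and counit an isomorphism (Gabriel–Popescu), let
`μ ≥ |R|` be infinite and `ν = μ⁺` its successor. Then for every regular cardinal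
`λ ≥ ν`: given `g : x ⟶ y` epi and `h : n ⟶ y` with `n` `λ`-presentable, there are a
`λ`-presentable object `m`, an epimorphism `q : m ⟶ n` and a morphism `r : m ⟶ x` with
`r ≫ g = q ≫ h`; moreover if `h` is a monomorphism then `r` may be chosen to be a
monomorphism. -/
theorem stmt_5 {𝒜 : Type u} [Category.{v} 𝒜] [Abelian 𝒜] [HasColimits 𝒜] [AB5 𝒜]
    [HasSeparator 𝒜]
    (R : Type v) [Ring R]
    (F : ModuleCat.{v} R ⥤ 𝒜) (G : 𝒜 ⥤ ModuleCat.{v} R)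
    [F.Additive] [G.Additive]
    (adj : F ⊣ G)
    [PreservesFiniteLimits F] [PreservesFiniteColimits F]
    (hcounit : IsIso adj.counit)
    (μ : Cardinal.{v}) (hμ : Cardinal.aleph0 ≤ μ) (hR : Cardinal.mk R ≤ μ)
    (ν : Cardinal.{v}) (hν : ν = Order.succ μ)
    (lam : Cardinal.{v}) (hreg : lam.IsRegular) (hlam : ν ≤ lam)
    (x y n : 𝒜) (g : x ⟶ y) (h : n ⟶ y) (hg : Epi g) (hn : IsPresentable lam n) :
    ∃ (m : 𝒜) (q : m ⟶ n) (r : m ⟶ x),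
      IsPresentable lam m ∧ Epi q ∧ r ≫ g = q ≫ h ∧ (Mono h → Mono r) := by
  have : Fact lam.IsRegular := ⟨hreg⟩
  have hμlam : μ < lam := (Order.lt_succ μ).trans_le (hν ▸ hlam)
  have : IsCardinalPresentable n lam := (isPresentable_iff_isCardinalPresentable n).1 hn
  obtain ⟨m, i, hm, hi, hip⟩ := exists_presentable_subobject_epi adj (hμ.trans_lt hμlam)
    (hR.trans_lt hμlam) (pullback.snd g h)
  refine ⟨m, i ≫ pullback.snd g h, i ≫ pullback.fst g h,
    (isPresentable_iff_isCardinalPresentable m).2 hm, hip, ?_, fun _ ↦ inferInstance⟩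
  simp [pullback.condition]
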